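/- arXiv:1905.03009 — 2 statements merged into one kernel-verified Lean document; each statement's English description precedes it below -/
import Mathlib

section
/- Let 1 ≤ k < N be integers, let a_1,…,a_N > 0 with a_+ := Σ_{i=1}^N a_i and a_+^{(k)} := Σ_{i=1}^k a_i, and assume a_+ − a_+^{(k)} > 1. Let c > 0, let μ be the product measure ⊗_{i=1}^N Gamma(a_i, c) on ℝ^N, and let Q_{N,k} be the pushforward of μ under the map x ↦ (x_1/x_+, …, x_k/x_+), where x_+ := Σ_{i=1}^N x_i (defined μ-a.e.); let P_k := ⊗_{i=1}^k Gamma(a_i, c) on ℝ^k. If either c = a_+ and δ := (a_+^{(k)} + 1)/a_+, or c = a_+ − 1 and δ := a_+^{(k)}/(a_+ − 1), then for every Borel set A ⊆ ℝ^k, Q_{N,k}(A) ≤ (1 − δ)^{−1/2} · P_k(A), and d_TV(Q_{N,k}, P_k) < 1 − √(1 − δ) < δ/(2 − δ). -/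
open MeasureTheory ProbabilityTheory

/-- The total variation distance `sup_A |Q(A) - P(A)|`. -/
noncomputable def tvDist {X : Type*} [MeasurableSpace X] (Q P : Measure X) : ℝ :=
  ⨆ A : {A : Set X // MeasurableSet A}, |(Q A.1).toReal - (P A.1).toReal|


noncomputable def hS (x : ℝ) : ℝ := Real.log (Real.Gamma (x + 1)) + x - (x + 1 / 2) * Real.log x

noncomputable def dS (x : ℝ) : ℝ := (x + 1 / 2) * (Real.log (x + 1) - Real.log x) - 1

lemma hS_sub (x : ℝ) (hx : 0 < x) : hS x - hS (x + 1) = dS x := by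
  have h1 : Real.log (Real.Gamma (x + 1 + 1)) = Real.log (x + 1) + Real.log (Real.Gamma (x + 1)) := by
    rw [Real.Gamma_add_one (by positivity), Real.log_mul (by positivity)]
    exact (Real.Gamma_pos_of_pos (by positivity)).ne'
  unfold hS dS
  rw [h1]; ring

lemma dS_anti : StrictAntiOn dS (Set.Ioi 0) := by
  have hd : ∀ x ∈ Set.Ioi (0:ℝ), HasDerivAt dS
      ((1 * (Real.log (x + 1) - Real.log x)) + (x + 1 / 2) * (1 / (x + 1) - 1 / x)) x := by
    intro x hx
    have hx : 0 < x := hx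
    unfold dS
    have h1 : HasDerivAt (fun x : ℝ => x + 1 / 2) 1 x := (hasDerivAt_id x).add_const _
    have h2 : HasDerivAt (fun x : ℝ => Real.log (x + 1)) (1 / (x + 1)) x :=
      ((hasDerivAt_id x).add_const 1).log (by simp; positivity)
    have h3 : HasDerivAt (fun x : ℝ => Real.log x) (1 / x) x := (hasDerivAt_id x).log hx.ne'
    exact (h1.mul (h2.sub h3)).sub_const 1
  apply strictAntiOn_of_deriv_neg (convex_Ioi 0)
  · exact fun x hx => (hd x hx).continuousAt.continuousWithinAt
  · intro x hx
    rw [interior_Ioi] at hx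
    rw [(hd x hx).deriv]
    have hx : 0 < x := hx
    have h1 : 1 < (x + 1) / x := by rw [lt_div_iff₀ hx]; linarith
    have h2 := Real.self_lt_sinh_iff.2 (Real.log_pos h1)
    rw [Real.sinh_log (by positivity), Real.log_div (by positivity) (by positivity)] at h2
    have : ((x + 1) / x - ((x + 1) / x)⁻¹) / 2 = - ((x + 1 / 2) * (1 / (x + 1) - 1 / x)) := by
      field_simp; ring
    linarith

lemma hS_tail (y c : ℝ) (hy : 0 < y) (hyc : y < c) :
    (c - y) * (y - c - 1 / 2) / c ≤ hS y - hS c := by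
  have hc : 0 < c := hy.trans hyc
  have h1 := Real.convexOn_log_Gamma.slope_mono_adjacent (x := y + 1) (y := c + 1) (z := c + 1 + 1)
    (by simp; positivity) (by simp; positivity) (by linarith) (by linarith)
  have h2 : Real.log (Real.Gamma (c + 1 + 1)) = Real.log (c + 1) + Real.log (Real.Gamma (c + 1)) := by
    rw [Real.Gamma_add_one (by positivity), Real.log_mul (by positivity)]
    exact (Real.Gamma_pos_of_pos (by positivity)).ne'
  simp only [Function.comp] at h1
  rw [h2, div_le_iff₀ (by linarith)] at h1
  have h3 : 1 - y / c ≤ Real.log c - Real.log y := by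
    have := Real.one_sub_inv_le_log_of_pos (x := c / y) (by positivity)
    rwa [Real.log_div hc.ne' hy.ne', inv_div] at this
  have h4 : Real.log (c + 1) - Real.log c ≤ 1 / c := by
    have := Real.log_le_sub_one_of_pos (x := (c + 1) / c) (by positivity)
    rw [Real.log_div (by positivity) hc.ne'] at this
    have e : (c + 1) / c - 1 = 1 / c := by field_simp; ring
    linarith
  have h5 := mul_le_mul_of_nonneg_left h3 (show 0 ≤ y + 1 / 2 by positivity)
  have h6 := mul_le_mul_of_nonneg_left h4 (show 0 ≤ c - y by linarith)
  have e : (c - y) * (y - c - 1 / 2) / c = (y + 1 / 2) * (1 - y / c) - (c - y) - (c - y) * (1 / c) := by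
    field_simp; ring
  rw [e]
  unfold hS
  have e2 : (c + 1 + 1 - (c + 1)) = 1 := by ring
  rw [e2] at h1
  nlinarith

lemma hS_lt (y c : ℝ) (hy : 0 < y) (hyc : y < c) : hS c < hS y := by
  have key : ∀ n : ℕ, hS y - hS c ≥ dS y - dS c + (hS (y + (n + 1)) - hS (c + (n + 1))) := by
    intro n
    induction n with
    | zero =>
      have h1 := hS_sub y hy
      have h2 := hS_sub c (hy.trans hyc)
      simp; linarith
    | succ n ih =>
      have h1 := hS_sub (y + (n + 1)) (by positivity)
      have h2 := hS_sub (c + (n + 1)) (by have := hy.trans hyc; positivity)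
      have h3 := dS_anti (a := y + (n + 1)) (b := c + (n + 1)) (by simp; positivity)
        (by have := hy.trans hyc; simp; positivity) (by linarith)
      push_cast
      rw [← add_assoc] at *
      rw [← add_assoc c] at *
      simp only [← add_assoc] at *
      linarith
  have h0 := dS_anti (a := y) (b := c) hy (hy.trans hyc) hyc
  have key2 : ∀ n : ℕ, (c - y) * (y - c - 1 / 2) / (c + (n + 1)) ≤ (hS y - hS c) - (dS y - dS c) := by
    intro n
    have := hS_tail (y + (n + 1)) (c + (n + 1)) (by positivity) (by linarith)
    have k := key n
    have e : (c + ((n:ℝ) + 1) - (y + (n + 1))) * (y + (n + 1) - (c + (n + 1)) - 1 / 2) =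
      (c - y) * (y - c - 1 / 2) := by ring
    rw [e] at this
    linarith
  have hl : Filter.Tendsto (fun n : ℕ => (c - y) * (y - c - 1 / 2) / (c + ((n:ℝ) + 1))) Filter.atTop (nhds 0) := by
    apply Filter.Tendsto.const_div_atTop
    apply Filter.tendsto_atTop_add_const_left
    apply Filter.tendsto_atTop_add_const_right
    exact tendsto_natCast_atTop_atTop
  have := le_of_tendsto' hl key2
  linarith

noncomputable def MM (c y : ℝ) : ℝ :=
  Real.Gamma (c + 1) / (Real.Gamma (y + 1) * c ^ (c - y)) * ((y / c) ^ y * Real.exp (c - y))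

lemma MM_pos (c y : ℝ) (hy : 0 < y) (hyc : y < c) : 0 < MM c y := by
  have hc : 0 < c := hy.trans hyc
  have h1 : 0 < Real.Gamma (c + 1) := Real.Gamma_pos_of_pos (by positivity)
  have h2 : 0 < Real.Gamma (y + 1) := Real.Gamma_pos_of_pos (by positivity)
  unfold MM; positivity

lemma MM_lt (c y : ℝ) (hy : 0 < y) (hyc : y < c) : MM c y < (y / c) ^ (-(1 / 2) : ℝ) := by
  have hc : 0 < c := hy.trans hyc
  have h1 : 0 < Real.Gamma (c + 1) := Real.Gamma_pos_of_pos (by positivity)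
  have h2 : 0 < Real.Gamma (y + 1) := Real.Gamma_pos_of_pos (by positivity)
  rw [← Real.log_lt_log_iff (MM_pos c y hy hyc) (by positivity), MM, Real.log_mul (by positivity) (by positivity),
    Real.log_div (by positivity) (by positivity), Real.log_mul (by positivity) (by positivity),
    Real.log_mul (by positivity) (by positivity), Real.log_exp, Real.log_rpow hc, Real.log_rpow (by positivity),
    Real.log_rpow (by positivity), Real.log_div (by positivity) (by positivity)]
  have := hS_lt y c hy hyc
  unfold hS at this
  nlinarith

lemma max_bound (c y t : ℝ) (hy : 0 < y) (hc : 0 < c) (ht : 0 ≤ t) :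
    t ^ y ≤ (y / c) ^ y * Real.exp (c * t - y) := by
  have h1 : t ≤ (y / c) * Real.exp (c * t / y - 1) := by
    have := Real.add_one_le_exp (c * t / y - 1)
    calc t = (y / c) * (c * t / y - 1 + 1) := by field_simp; ring
      _ ≤ _ := by gcongr
  calc t ^ y ≤ ((y / c) * Real.exp (c * t / y - 1)) ^ y := by gcongr
    _ = _ := by
      rw [Real.mul_rpow (by positivity) (by positivity), ← Real.exp_mul]
      congr 2; field_simp

lemma last_bound (δ : ℝ) (h0 : 0 < δ) (h1 : δ < 1) : 1 - Real.sqrt (1 - δ) < δ / (2 - δ) := by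
  rw [lt_div_iff₀ (by linarith)]
  have hr := Real.sq_sqrt (show 0 ≤ 1 - δ by linarith)
  have hp := Real.sqrt_pos.2 (show 0 < 1 - δ by linarith)
  set r := Real.sqrt (1 - δ)
  have hr1 : r < 1 := by nlinarith
  have : δ = 1 - r ^ 2 := by linarith
  rw [this]
  nlinarith [mul_pos hp (sub_pos.2 hr1), mul_pos (mul_pos hp (sub_pos.2 hr1)) (sub_pos.2 hr1)]

open scoped ENNReal

lemma lint_prod {n : ℕ} (μ : Fin n → Measure ℝ) [∀ i, SigmaFinite (μ i)]
    (f : Fin n → ℝ → ℝ≥0∞) (hf : ∀ i, Measurable (f i)) :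
    ∫⁻ x : Fin n → ℝ, ∏ i, f i (x i) ∂(Measure.pi μ) = ∏ i, ∫⁻ x, f i x ∂(μ i) := by
  induction n with
  | zero => simp
  | succ n n_ih =>
      calc
        _ = ∫⁻ x : ℝ × (Fin n → ℝ),
            f 0 x.1 * ∏ i : Fin n, f (Fin.succ i) (x.2 i)
            ∂((μ 0).prod (Measure.pi (fun i ↦ μ i.succ))) := by
          rw [← ((measurePreserving_piFinSuccAbove μ 0).symm).lintegral_comp_emb
            (MeasurableEquiv.measurableEmbedding _)]
          simp_rw [MeasurableEquiv.piFinSuccAbove_symm_apply, Fin.insertNthEquiv,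
            Fin.prod_univ_succ, Fin.insertNth_zero, Equiv.coe_fn_mk, Fin.cons_succ,
            Fin.zero_succAbove, Fin.cons_zero]
          rfl
        _ = (∫⁻ x, f 0 x ∂μ 0)
            * ∏ i : Fin n, ∫⁻ x, f (Fin.succ i) x ∂(μ i.succ) := by
          rw [← n_ih (fun i => μ i.succ) (fun i => f i.succ) (fun i => hf _)]
          have hm2 : Measurable (fun y : Fin n → ℝ => ∏ i : Fin n, f (Fin.succ i) (y i)) := by
            fun_prop
          exact lintegral_prod_mul (hf 0).aemeasurable hm2.aemeasurable
        _ = _ := by rw [Fin.prod_univ_succ]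

lemma meas_gammaPDF (a c : ℝ) : Measurable (gammaPDF a c) :=
  (measurable_gammaPDFReal a c).ennreal_ofReal

lemma pi_gamma {k : ℕ} (a : Fin k → ℝ) (c : ℝ) (ha : ∀ i, 0 < a i) (hc : 0 < c) :
    Measure.pi (fun i => gammaMeasure (a i) c) =
      (volume : Measure (Fin k → ℝ)).withDensity (fun x => ∏ i, gammaPDF (a i) c (x i)) := by
  have : ∀ i, IsProbabilityMeasure (gammaMeasure (a i) c) :=
    fun i => isProbabilityMeasure_gammaMeasure (ha i) hc
  apply Measure.pi_eq
  intro s hs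
  rw [withDensity_apply _ (MeasurableSet.univ_pi hs), volume_pi, Measure.restrict_pi_pi,
    lint_prod _ _ (fun i => meas_gammaPDF _ _)]
  refine Finset.prod_congr rfl fun i _ => ?_
  rw [gammaMeasure, withDensity_apply _ (hs i)]

noncomputable def gg (a x : ℝ) : ℝ := if 0 ≤ x then x ^ (a - 1) / Real.Gamma a else 0

lemma meas_gg (a : ℝ) : Measurable (gg a) :=
  Measurable.ite measurableSet_Ici ((measurable_id'.pow_const _).div_const _) measurable_const

lemma gg_nonneg (a x : ℝ) (ha : 0 < a) : 0 ≤ gg a x := by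
  have := Real.Gamma_pos_of_pos ha
  unfold gg; split_ifs <;> positivity

lemma gamma_scale (a c S u : ℝ) (hS : 0 < S) :
    gammaPDFReal a c (S * u) = c ^ a * S ^ (a - 1) * Real.exp (-(c * S * u)) * gg a u := by
  unfold gammaPDFReal gg
  by_cases hu : 0 ≤ u
  · rw [if_pos hu, if_pos (by positivity), Real.mul_rpow hS.le hu]
    ring_nf
  · rw [if_neg hu, if_neg (by rw [mul_nonneg_iff_of_pos_left hS]; exact hu), mul_zero]

noncomputable def DD {k : ℕ} (a : Fin k → ℝ) (b : ℝ) (u : Fin k → ℝ) : ℝ :=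
  Real.Gamma (∑ i, a i + b) * ((∏ i, gg (a i) (u i)) * gg b (1 - ∑ i, u i))

lemma meas_DD {k : ℕ} (a : Fin k → ℝ) (b : ℝ) : Measurable (DD a b) := by
  unfold DD
  have h1 := fun i => meas_gg (a i)
  have h2 := meas_gg b
  fun_prop

lemma prod_gamma_scale {k : ℕ} (a : Fin k → ℝ) (c S : ℝ) (u : Fin k → ℝ) (hS : 0 < S) (hc : 0 < c) :
    ∏ i, gammaPDFReal (a i) c (S * u i) =
      c ^ (∑ i, a i) * S ^ (∑ i, a i - k) * Real.exp (-(c * S * ∑ i, u i)) * ∏ i, gg (a i) (u i) := by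
  simp_rw [gamma_scale _ _ _ _ hS, Finset.prod_mul_distrib]
  rw [← Real.rpow_sum_of_pos hc, ← Real.rpow_sum_of_pos hS, ← Real.exp_sum]
  simp [Finset.mul_sum]

lemma key_pt {k : ℕ} (a : Fin k → ℝ) (b c S : ℝ) (u : Fin k → ℝ) (ha : ∀ i, 0 < a i) (hb : 0 < b)
    (hS : 0 < S) (hc : 0 < c) :
    ENNReal.ofReal (S ^ k) * ((∏ i, gammaPDF (a i) c (S * u i)) * gammaPDF b c (S - ∑ i, S * u i)) =
      ENNReal.ofReal (DD a b u) * gammaPDF (∑ i, a i + b) c S := by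
  have hA : 0 < ∑ i, a i + b := by
    have := Finset.sum_nonneg (s := Finset.univ) (fun i _ => (ha i).le); linarith
  have hg := Real.Gamma_pos_of_pos hA
  have hD : 0 ≤ DD a b u := by
    unfold DD
    have h1 := Finset.prod_nonneg (s := Finset.univ) (fun i _ => gg_nonneg (a i) (u i) (ha i))
    have h2 := gg_nonneg b (1 - ∑ i, u i) hb
    positivity
  have e : S - ∑ i, S * u i = S * (1 - ∑ i, u i) := by rw [← Finset.mul_sum]; ring
  rw [e]
  unfold gammaPDF
  rw [← ENNReal.ofReal_prod_of_nonneg (fun i _ => gammaPDFReal_nonneg (ha i) hc _),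
    ← ENNReal.ofReal_mul (Finset.prod_nonneg (fun i _ => gammaPDFReal_nonneg (ha i) hc _)),
    ← ENNReal.ofReal_mul (by positivity), ← ENNReal.ofReal_mul hD]
  congr 1
  rw [prod_gamma_scale a c S u hS hc, gamma_scale _ _ _ _ hS]
  unfold DD gammaPDFReal
  rw [if_pos hS.le]
  have e1 : Real.exp (-(c * S)) = Real.exp (-(c * S * ∑ i, u i)) * Real.exp (-(c * S * (1 - ∑ i, u i))) := by
    rw [← Real.exp_add]; congr 1; ring
  have e2 : S ^ (∑ i, a i + b - 1) = S ^ k * S ^ (∑ i, a i - k) * S ^ (b - 1) := by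
    rw [← Real.rpow_natCast, ← Real.rpow_add hS, ← Real.rpow_add hS]; congr 1; ring
  rw [e1, e2, Real.rpow_add hc]
  field_simp

lemma lint_scale {k : ℕ} (S : ℝ) (hS : 0 < S) (f : (Fin k → ℝ) → ℝ≥0∞) (hf : Measurable f) :
    ∫⁻ x, f x = ENNReal.ofReal (S ^ k) * ∫⁻ u, f (S • u) := by
  have h := Measure.map_addHaar_smul (volume : Measure (Fin k → ℝ)) hS.ne'
  have h2 : ∫⁻ u, f (S • u) = ∫⁻ x, f x ∂(Measure.map (S • ·) (volume : Measure (Fin k → ℝ))) := by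
    rw [lintegral_map hf (by fun_prop)]
  rw [h2, h, lintegral_smul_measure, smul_eq_mul, ← mul_assoc, ← ENNReal.ofReal_mul (by positivity)]
  simp
  rw [abs_of_pos hS, mul_inv_cancel₀ (by positivity)]
  simp

lemma main_int {k : ℕ} (a : Fin k → ℝ) (b c : ℝ) (ha : ∀ i, 0 < a i) (hb : 0 < b) (hc : 0 < c)
    (H : (Fin k → ℝ) → ℝ → ℝ≥0∞) (hH : Measurable (Function.uncurry H)) :
    ∫⁻ z, H (fun i => z.1 i / (∑ j, z.1 j + z.2)) (∑ j, z.1 j + z.2)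
      ∂((Measure.pi (fun i => gammaMeasure (a i) c)).prod (gammaMeasure b c)) =
    ∫⁻ u, ∫⁻ S, H u S * (ENNReal.ofReal (DD a b u) * gammaPDF (∑ i, a i + b) c S) := by
  have hm := fun a => meas_gammaPDF a c
  have hmD : Measurable (DD a b) := meas_DD a b
  have hHm : ∀ {α : Type} [MeasurableSpace α] (f : α → (Fin k → ℝ)) (g : α → ℝ), Measurable f →
      Measurable g → Measurable (fun x => H (f x) (g x)) := fun f g hf hg => hH.comp (hf.prodMk hg)
  rw [pi_gamma a c ha hc, gammaMeasure, prod_withDensity (by fun_prop) (hm b),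
    lintegral_withDensity_eq_lintegral_mul _ (by fun_prop)
      (hHm _ _ (by fun_prop) (by fun_prop))]
  simp only [Pi.mul_apply]
  have M1 : Measurable (fun z : (Fin k → ℝ) × ℝ => (∏ i, gammaPDF (a i) c (z.1 i)) * gammaPDF b c z.2 *
    H (fun i => z.1 i / (∑ j, z.1 j + z.2)) (∑ j, z.1 j + z.2)) := by
    have := hHm (fun z : (Fin k → ℝ) × ℝ => (fun i => z.1 i / (∑ j, z.1 j + z.2)))
      (fun z => (∑ j, z.1 j + z.2)) (by fun_prop) (by fun_prop)
    fun_prop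
  have M2 : Measurable (fun z : (Fin k → ℝ) × ℝ => (∏ i, gammaPDF (a i) c (z.1 i)) * gammaPDF b c (z.2 - ∑ j, z.1 j) *
    H (fun i => z.1 i / z.2) z.2) := by
    have := hHm (fun z : (Fin k → ℝ) × ℝ => (fun i => z.1 i / z.2))
      (fun z => z.2) (by fun_prop) (by fun_prop)
    fun_prop
  have M3 : Measurable (fun z : (Fin k → ℝ) × ℝ =>
      H z.1 z.2 * (ENNReal.ofReal (DD a b z.1) * gammaPDF (∑ i, a i + b) c z.2)) := by
    have := hHm (fun z : (Fin k → ℝ) × ℝ => z.1) (fun z => z.2) (by fun_prop) (by fun_prop)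
    fun_prop
  rw [lintegral_prod _ M1.aemeasurable]
  have s1 : ∀ x : Fin k → ℝ, ∫⁻ t, (∏ i, gammaPDF (a i) c (x i)) * gammaPDF b c t *
      H (fun i => x i / (∑ j, x j + t)) (∑ j, x j + t) =
      ∫⁻ S, (∏ i, gammaPDF (a i) c (x i)) * gammaPDF b c (S - ∑ j, x j) * H (fun i => x i / S) S := by
    intro x
    have := lintegral_add_left_eq_self (μ := (volume : Measure ℝ))
      (fun S => (∏ i, gammaPDF (a i) c (x i)) * gammaPDF b c (S - ∑ j, x j) * H (fun i => x i / S) S)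
      (∑ j, x j)
    rw [← this]
    simp
  simp only [s1]
  rw [lintegral_lintegral_swap M2.aemeasurable]
  conv_rhs => rw [lintegral_lintegral_swap M3.aemeasurable]
  have h0 : ∀ᵐ S : ℝ, S ≠ 0 := by simp [ae_iff]
  suffices hpt : ∀ S : ℝ, S ≠ 0 →
      ∫⁻ x : Fin k → ℝ, (∏ i, gammaPDF (a i) c (x i)) * gammaPDF b c (S - ∑ j, x j) *
        H (fun i => x i / S) S =
      ∫⁻ x, H x S * (ENNReal.ofReal (DD a b x) * gammaPDF (∑ i, a i + b) c S) from
    lintegral_congr_ae (h0.mono hpt)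
  intro S hS0
  have M4 : Measurable (fun x : Fin k → ℝ => (∏ i, gammaPDF (a i) c (x i)) *
      gammaPDF b c (S - ∑ j, x j) * H (fun i => x i / S) S) := by
    have := hHm (fun x : Fin k → ℝ => (fun i => x i / S)) (fun _ => S) (by fun_prop) (by fun_prop)
    fun_prop
  rcases lt_or_gt_of_ne hS0 with hS | hS
  · simp only [gammaPDF_of_neg hS, mul_zero, lintegral_zero]
    rw [← lintegral_zero (μ := (volume : Measure (Fin k → ℝ)))]
    apply lintegral_congr
    intro x
    by_cases hx : ∀ i, 0 ≤ x i
    · rw [gammaPDF_of_neg (x := S - ∑ j, x j)]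
      · simp
      · have := Finset.sum_nonneg (s := Finset.univ) (fun i _ => hx i); linarith
    · push Not at hx
      obtain ⟨i, hi⟩ := hx
      rw [Finset.prod_eq_zero (Finset.mem_univ i) (gammaPDF_of_neg hi)]; simp
  · rw [lint_scale S hS _ M4,
      ← lintegral_const_mul']
    · apply lintegral_congr
      intro u
      simp only [Pi.smul_apply, smul_eq_mul]
      have : (fun i => S * u i / S) = u := by ext i; field_simp
      rw [this, ← key_pt a b c S u ha hb hS hc]
      ring
    · simp

lemma sum_law {k : ℕ} (a : Fin k → ℝ) (b c : ℝ) (ha : ∀ i, 0 < a i) (hb : 0 < b) (hc : 0 < c) :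
    Measure.map (fun z : (Fin k → ℝ) × ℝ => ∑ j, z.1 j + z.2)
      ((Measure.pi (fun i => gammaMeasure (a i) c)).prod (gammaMeasure b c)) =
      gammaMeasure (∑ i, a i + b) c := by
  have hA : 0 < ∑ i, a i + b := by
    have := Finset.sum_nonneg (s := Finset.univ) (fun i _ => (ha i).le); linarith
  have i1 : ∀ i, IsProbabilityMeasure (gammaMeasure (a i) c) :=
    fun i => isProbabilityMeasure_gammaMeasure (ha i) hc
  have i2 := isProbabilityMeasure_gammaMeasure hb hc
  have i3 := isProbabilityMeasure_gammaMeasure hA hc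
  have hf : Measurable (fun z : (Fin k → ℝ) × ℝ => ∑ j, z.1 j + z.2) := by fun_prop
  have i4 := Measure.isProbabilityMeasure_map (μ := ((Measure.pi (fun i => gammaMeasure (a i) c)).prod (gammaMeasure b c))) hf.aemeasurable
  have key : ∀ B : Set ℝ, MeasurableSet B → Measure.map (fun z : (Fin k → ℝ) × ℝ => ∑ j, z.1 j + z.2)
      ((Measure.pi (fun i => gammaMeasure (a i) c)).prod (gammaMeasure b c)) B =
      (∫⁻ u, ENNReal.ofReal (DD a b u)) * gammaMeasure (∑ i, a i + b) c B := by
    intro B hB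
    have h1 : Measurable (B.indicator (1 : ℝ → ℝ≥0∞)) := measurable_one.indicator hB
    have := main_int a b c ha hb hc (fun _ S => B.indicator 1 S) (h1.comp measurable_snd)
    rw [← lintegral_indicator_one hB, lintegral_map h1 hf, this, gammaMeasure, withDensity_apply _ hB,
      ← lintegral_indicator hB, ← lintegral_mul_const]
    · apply lintegral_congr
      intro u
      rw [← lintegral_const_mul]
      · apply lintegral_congr
        intro S
        by_cases hS : S ∈ B <;> simp [hS]
      · exact (meas_gammaPDF _ _).indicator hB
    · exact (meas_DD a b).ennreal_ofReal
  have h1 := key Set.univ MeasurableSet.univ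
  rw [measure_univ, measure_univ, mul_one] at h1
  ext B hB
  rw [key B hB, ← h1, one_mul]

lemma ratio_law {k : ℕ} (a : Fin k → ℝ) (b c : ℝ) (ha : ∀ i, 0 < a i) (hb : 0 < b) (hc : 0 < c)
    (B : Set (Fin k → ℝ)) (hB : MeasurableSet B) :
    Measure.map (fun z : (Fin k → ℝ) × ℝ => fun i => z.1 i / (∑ j, z.1 j + z.2))
      ((Measure.pi (fun i => gammaMeasure (a i) c)).prod (gammaMeasure b c)) B =
      ∫⁻ u in B, ENNReal.ofReal (DD a b u) := by
  have hA : 0 < ∑ i, a i + b := by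
    have := Finset.sum_nonneg (s := Finset.univ) (fun i _ => (ha i).le); linarith
  have hf : Measurable (fun z : (Fin k → ℝ) × ℝ => fun i => z.1 i / (∑ j, z.1 j + z.2)) := by fun_prop
  have h1 : Measurable (B.indicator (1 : (Fin k → ℝ) → ℝ≥0∞)) := measurable_one.indicator hB
  have := main_int a b c ha hb hc (fun u _ => B.indicator 1 u) (h1.comp measurable_fst)
  rw [← lintegral_indicator_one hB, lintegral_map h1 hf, this, ← lintegral_indicator hB]
  apply lintegral_congr
  intro u
  simp_rw [← mul_assoc]
  rw [lintegral_const_mul _ (meas_gammaPDF _ _), lintegral_gammaPDF_eq_one hA hc, mul_one]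
  by_cases hS : u ∈ B <;> simp [hS]

lemma pi_append {k m : ℕ} (μ : Fin (k + m) → Measure ℝ) [∀ i, IsProbabilityMeasure (μ i)] :
    Measure.pi μ = Measure.map (fun z : (Fin k → ℝ) × (Fin m → ℝ) => Fin.append z.1 z.2)
      ((Measure.pi fun i => μ (Fin.castAdd m i)).prod (Measure.pi fun i => μ (Fin.natAdd k i))) := by
  have hm : Measurable (fun z : (Fin k → ℝ) × (Fin m → ℝ) => Fin.append z.1 z.2) := by
    refine measurable_pi_lambda _ fun i => ?_
    refine Fin.addCases (fun i => ?_) (fun i => ?_) i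
    · simp only [Fin.append_left]; fun_prop
    · simp only [Fin.append_right]; fun_prop
  apply Measure.pi_eq
  intro s hs
  rw [Measure.map_apply hm (MeasurableSet.univ_pi hs), Fin.prod_univ_add, ← Measure.pi_pi,
    ← Measure.pi_pi, ← Measure.prod_prod]
  congr 1
  ext z
  simp only [Set.mem_preimage, Set.mem_pi, Set.mem_univ, true_imp_iff, Set.mem_prod]
  constructor
  · intro h
    exact ⟨fun i => by simpa using h (Fin.castAdd m i), fun i => by simpa using h (Fin.natAdd k i)⟩
  · rintro ⟨h1, h2⟩ i
    refine Fin.addCases (fun i => ?_) (fun i => ?_) i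
    · simpa using h1 i
    · simpa using h2 i

lemma meas_append {k m : ℕ} :
    Measurable (fun z : (Fin k → ℝ) × (Fin m → ℝ) => Fin.append z.1 z.2) := by
  refine measurable_pi_lambda _ fun i => ?_
  refine Fin.addCases (fun i => ?_) (fun i => ?_) i
  · simp only [Fin.append_left]; fun_prop
  · simp only [Fin.append_right]; fun_prop

lemma sum_law_fin {m : ℕ} (a : Fin (m + 1) → ℝ) (c : ℝ) (ha : ∀ i, 0 < a i) (hc : 0 < c) :
    Measure.map (fun x : Fin (m + 1) → ℝ => ∑ j, x j) (Measure.pi (fun i => gammaMeasure (a i) c)) =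
      gammaMeasure (∑ i, a i) c := by
  have i1 : ∀ i, IsProbabilityMeasure (gammaMeasure (a i) c) :=
    fun i => isProbabilityMeasure_gammaMeasure (ha i) hc
  have mp := (measurePreserving_piFinSuccAbove (fun i => gammaMeasure (a i) c) 0)
  have hs := sum_law (fun i : Fin m => a i.succ) (a 0) c (fun i => ha _) (ha 0) hc
  rw [Fin.sum_univ_succ, add_comm (a 0), ← hs, ← Measure.prod_swap, Measure.map_map (by fun_prop) (by fun_prop)]
  simp only [Fin.zero_succAbove] at mp
  rw [← mp.map_eq, Measure.map_map (by fun_prop) (by fun_prop)]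
  congr 1
  ext x
  simp [Fin.sum_univ_succ, MeasurableEquiv.piFinSuccAbove, Fin.insertNthEquiv, Fin.tail, add_comm]

lemma Q_law {k m : ℕ} (a : Fin (k + (m + 1)) → ℝ) (c : ℝ) (ha : ∀ i, 0 < a i) (hc : 0 < c)
    (B : Set (Fin k → ℝ)) (hB : MeasurableSet B) :
    Measure.map (fun x : Fin (k + (m + 1)) → ℝ => fun i : Fin k => x (Fin.castAdd _ i) / ∑ j, x j)
      (Measure.pi fun i => gammaMeasure (a i) c) B =
      ∫⁻ u in B, ENNReal.ofReal (DD (fun i => a (Fin.castAdd _ i)) (∑ i, a (Fin.natAdd k i)) u) := by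
  have i1 : ∀ i, IsProbabilityMeasure (gammaMeasure (a i) c) :=
    fun i => isProbabilityMeasure_gammaMeasure (ha i) hc
  have hb : 0 < ∑ i : Fin (m + 1), a (Fin.natAdd k i) :=
    Finset.sum_pos (fun i _ => ha _) Finset.univ_nonempty
  rw [← ratio_law _ _ c (fun i => ha _) hb hc B hB, ← sum_law_fin _ c (fun i => ha _) hc,
    pi_append, Measure.map_map (by fun_prop) meas_append]
  have := Measure.map_prod_map (Measure.pi fun i : Fin k => gammaMeasure (a (Fin.castAdd (m+1) i)) c)
    (Measure.pi fun i : Fin (m+1) => gammaMeasure (a (Fin.natAdd k i)) c)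
    (f := id) (g := fun x : Fin (m + 1) → ℝ => ∑ j, x j) measurable_id (by fun_prop)
  rw [Measure.map_id] at this
  rw [this, Measure.map_map (by fun_prop) (by fun_prop)]
  congr 1
  congr 1
  ext z i
  simp [Fin.sum_univ_add]

lemma DD_le {k : ℕ} (a : Fin k → ℝ) (b c : ℝ) (ha : ∀ i, 0 < a i) (hb : 1 < b) (hyc : b - 1 < c)
    (hcase : Real.Gamma (∑ i, a i + b) / c ^ (∑ i, a i) = Real.Gamma (c + 1) / c ^ (c - (b - 1)))
    (u : Fin k → ℝ) :
    ENNReal.ofReal (DD a b u) ≤ ENNReal.ofReal (MM c (b - 1)) * ∏ i, gammaPDF (a i) c (u i) := by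
  have hc : 0 < c := by linarith
  have hM := MM_pos c (b - 1) (by linarith) hyc
  unfold gammaPDF
  rw [← ENNReal.ofReal_prod_of_nonneg (fun i _ => gammaPDFReal_nonneg (ha i) hc _),
    ← ENNReal.ofReal_mul hM.le]
  apply ENNReal.ofReal_le_ofReal
  have h := prod_gamma_scale a c 1 u one_pos hc
  simp only [one_mul, Real.one_rpow, mul_one] at h
  rw [h]
  have hG := Finset.prod_nonneg (s := Finset.univ) (fun i _ => gg_nonneg (a i) (u i) (ha i))
  unfold DD
  have hgb := Real.Gamma_pos_of_pos (show 0 < b by linarith)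
  have hgc := Real.Gamma_pos_of_pos (show 0 < c + 1 by linarith)
  suffices hs : Real.Gamma (∑ i, a i + b) * gg b (1 - ∑ i, u i) ≤
      MM c (b - 1) * (c ^ (∑ i, a i) * Real.exp (-(c * ∑ i, u i))) by
    have := mul_le_mul_of_nonneg_right hs hG
    linarith
  unfold gg
  split_ifs with ht
  · have hmb := max_bound c (b - 1) (1 - ∑ i, u i) (by linarith) hc ht
    have eA : Real.Gamma (∑ i, a i + b) = c ^ (∑ i, a i) * (Real.Gamma (c + 1) / c ^ (c - (b - 1))) := by
      rw [← hcase]; field_simp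
    have ee : Real.exp (c * (1 - ∑ i, u i) - (b - 1)) =
        Real.exp (c - (b - 1)) * Real.exp (-(c * ∑ i, u i)) := by
      rw [← Real.exp_add]; congr 1; ring
    rw [ee] at hmb
    have e1 : b - 1 + 1 = b := by ring
    rw [eA, MM, e1]
    calc _ ≤ c ^ (∑ i, a i) * (Real.Gamma (c + 1) / c ^ (c - (b - 1))) *
          (((b - 1) / c) ^ (b - 1) * (Real.exp (c - (b - 1)) * Real.exp (-(c * ∑ i, u i))) / Real.Gamma b) := by
          gcongr
      _ = _ := by field_simp
  · rw [mul_zero]; positivity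

lemma tv_lt {X : Type*} [MeasurableSpace X] (Q P : Measure X) [IsProbabilityMeasure Q]
    [IsProbabilityMeasure P] (M : ℝ) (hM : 0 < M)
    (h : ∀ A, MeasurableSet A → Q A ≤ ENNReal.ofReal M * P A) : tvDist Q P ≤ 1 - M⁻¹ := by
  have h1 : ∀ A, MeasurableSet A → Q.real A - P.real A ≤ 1 - M⁻¹ := by
    have hr : ∀ A, MeasurableSet A → Q.real A ≤ M * P.real A := by
      intro A hA
      have := ENNReal.toReal_mono (by finiteness) (h A hA)
      rwa [ENNReal.toReal_mul, ENNReal.toReal_ofReal hM.le] at this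
    intro A hA
    have h2 := hr A hA
    have h3 : Q.real A ≤ 1 := measureReal_le_one
    have hM1 : 1 ≤ M := by simpa using hr Set.univ MeasurableSet.univ
    have h4 : M⁻¹ * Q.real A ≤ P.real A := by
      rw [inv_mul_le_iff₀ hM]; exact h2
    have h5 : M⁻¹ ≤ 1 := inv_le_one_of_one_le₀ hM1
    nlinarith
  have : Nonempty {A : Set X // MeasurableSet A} := ⟨⟨∅, MeasurableSet.empty⟩⟩
  apply ciSup_le
  rintro ⟨A, hA⟩
  have h2 := h1 A hA
  have h3 := h1 Aᶜ hA.compl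
  rw [probReal_compl_eq_one_sub hA, probReal_compl_eq_one_sub hA] at h3
  simp only [Measure.real] at h2 h3
  rw [abs_le]; constructor <;> linarith

/-- Corollary 2 (Dirichlet distributions): with `a_1,…,a_N > 0`,
`a_+ = Σ_{i=1}^N a_i`, `a_+^{(k)} = Σ_{i=1}^k a_i > a_+ - 1`... precisely assuming
`a_+ - a_+^{(k)} > 1`, let `Q_{N,k}` be the law of the first `k` coordinates of the
Dirichlet vector `(X_1/X_+,…,X_N/X_+)` built from independent `X_i ∼ Gamma(a_i,c)`,
and `P_k = ⊗_{i≤k} Gamma(a_i,c)`. If `c = a_+`, `δ = (a_+^{(k)}+1)/a_+`, or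
`c = a_+ - 1`, `δ = a_+^{(k)}/(a_+ - 1)`, then `Q_{N,k}(A) ≤ (1-δ)^{-1/2} P_k(A)`
for all Borel `A`, and `d_TV(Q_{N,k}, P_k) < 1 - √(1-δ) < δ/(2-δ)`. -/
theorem dirichlet_gamma_approx (N k : ℕ) (hk : 1 ≤ k) (hkN : k < N)
    (a : Fin N → ℝ) (ha : ∀ i, 0 < a i) (c δ : ℝ) (hc : 0 < c)
    (hgap : (∑ i, a i) - (∑ i : Fin k, a ⟨i.1, by omega⟩) > 1)
    (hcase : (c = ∑ i, a i ∧
                δ = ((∑ i : Fin k, a ⟨i.1, by omega⟩) + 1) / (∑ i, a i)) ∨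
             (c = (∑ i, a i) - 1 ∧
                δ = (∑ i : Fin k, a ⟨i.1, by omega⟩) / ((∑ i, a i) - 1)))
    (Q P : Measure (Fin k → ℝ))
    (hQ : Q = Measure.map
      (fun x : Fin N → ℝ => fun i : Fin k => x ⟨i.1, by omega⟩ / ∑ j, x j)
      (Measure.pi fun i : Fin N => gammaMeasure (a i) c))
    (hP : P = Measure.pi fun i : Fin k => gammaMeasure (a ⟨i.1, by omega⟩) c) :
    (∀ A : Set (Fin k → ℝ), MeasurableSet A →
      Q A ≤ ENNReal.ofReal ((1 - δ) ^ (-(1 / 2) : ℝ)) * P A) ∧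
    tvDist Q P < 1 - Real.sqrt (1 - δ) ∧
    1 - Real.sqrt (1 - δ) < δ / (2 - δ) := by
  obtain ⟨m, rfl⟩ : ∃ m, N = k + (m + 1) := ⟨N - k - 1, by omega⟩
  have hi : ∀ i : Fin k, (⟨i.1, by omega⟩ : Fin (k + (m + 1))) = Fin.castAdd (m + 1) i := fun i => rfl
  simp only [hi] at hgap hcase hQ hP
  rw [Fin.sum_univ_add] at hgap hcase
  have haa : ∀ i : Fin k, 0 < a (Fin.castAdd (m + 1) i) := fun i => ha _
  have hα : 0 < ∑ i : Fin k, a (Fin.castAdd (m + 1) i) :=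
    Finset.sum_pos (fun i _ => ha _) ⟨⟨0, by omega⟩, Finset.mem_univ _⟩
  have hlaw := fun B hB => Q_law a c ha hc B hB
  rw [← hQ] at hlaw
  have i1 : ∀ i, IsProbabilityMeasure (gammaMeasure (a i) c) :=
    fun i => isProbabilityMeasure_gammaMeasure (ha i) hc
  have iP : IsProbabilityMeasure P := by rw [hP]; infer_instance
  have iQ : IsProbabilityMeasure Q := by
    rw [hQ]; exact Measure.isProbabilityMeasure_map (by fun_prop)
  rw [pi_gamma _ c haa hc] at hP
  set a' : Fin k → ℝ := fun i => a (Fin.castAdd (m + 1) i) with ha'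
  set b : ℝ := ∑ i, a (Fin.natAdd k i) with hbdef
  change 0 < ∑ i, a' i at hα
  change ∑ i, a' i + b - ∑ i, a' i > 1 at hgap
  change (c = ∑ i, a' i + b ∧ δ = (∑ i, a' i + 1) / (∑ i, a' i + b)) ∨
    (c = ∑ i, a' i + b - 1 ∧ δ = (∑ i, a' i) / (∑ i, a' i + b - 1)) at hcase
  have hb : 1 < b := by linarith
  have hδ : 1 - δ = (b - 1) / c := by
    rcases hcase with ⟨h1, h2⟩ | ⟨h1, h2⟩
    · rw [h2, ← h1]; field_simp; linarith
    · rw [h2, ← h1]; field_simp; linarith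
  have hyc : b - 1 < c := by
    rcases hcase with ⟨h1, h2⟩ | ⟨h1, h2⟩ <;> linarith
  have hcase' : Real.Gamma (∑ i, a' i + b) / c ^ (∑ i, a' i) =
      Real.Gamma (c + 1) / c ^ (c - (b - 1)) := by
    rcases hcase with ⟨h1, h2⟩ | ⟨h1, h2⟩
    · have e : c - (b - 1) = ∑ i, a' i + 1 := by linarith
      rw [← h1, e, Real.rpow_add hc, Real.Gamma_add_one hc.ne', Real.rpow_one]
      field_simp
    · have e : c - (b - 1) = ∑ i, a' i := by linarith
      have e2 : ∑ i, a' i + b = c + 1 := by linarith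
      rw [e, e2]
  have hMp := MM_pos c (b - 1) (by linarith) hyc
  have hMl := MM_lt c (b - 1) (by linarith) hyc
  have hδ0 : 0 < 1 - δ := by rw [hδ]; exact div_pos (by linarith) hc
  have hδ1 : 0 < δ := by
    have : 1 - δ < 1 := by rw [hδ, div_lt_one hc]; exact hyc
    linarith
  rw [← hδ] at hMl
  have hQP : ∀ A : Set (Fin k → ℝ), MeasurableSet A → Q A ≤ ENNReal.ofReal (MM c (b - 1)) * P A := by
    intro A hA
    rw [hlaw A hA, hP, withDensity_apply _ hA, ← lintegral_const_mul']
    · exact lintegral_mono fun u => DD_le a' b c haa hb hyc hcase' u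
    · simp
  refine ⟨fun A hA => (hQP A hA).trans ?_, ?_, last_bound δ hδ1 (by linarith)⟩
  · gcongr
  · refine (tv_lt Q P _ hMp hQP).trans_lt ?_
    have e : (1 - δ) ^ (-(1 / 2) : ℝ) = (Real.sqrt (1 - δ))⁻¹ := by
      rw [Real.rpow_neg hδ0.le, Real.sqrt_eq_rpow]
    rw [e] at hMl
    have := inv_strictAnti₀ hMp hMl
    rw [inv_inv] at this
    linarith
end

section
/- Let 1 ≤ k < n be integers. Let λ_n be the n-fold product of the uniform distribution on [0,1], and for u ∈ [0,1]^n let 0 =: u_{(0)} ≤ u_{(1)} ≤ ⋯ ≤ u_{(n)} denote the sorted (nondecreasing) rearrangement of u_1,…,u_n preceded by 0. Let Q_{n,k} be the pushforward of λ_n under the map u ↦ (n·(u_{(j)} − u_{(j−1)}))_{j=1}^k, and let P_k be the k-fold product of the standard exponential distribution (density e^{−x} on (0,∞)). Then for every Borel set A ⊆ ℝ^k, Q_{n,k}(A) ≤ (1 − k/n)^{−1/2} · P_k(A), and in the case k = 1 the stronger bound Q_{n,1}(A) ≤ exp(1/(2n) + 1/(4n²)) · P_1(A) holds; consequently d_TV(Q_{n,k},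 P_k) ≤ 1 − √(1 − k/n) < k/(2n − k), and d_TV(Q_{n,1}, P_1) ≤ 1/(2n) + 1/(4n²). -/
open MeasureTheory ProbabilityTheory

/-- The `j`-th order statistic of `u : Fin n → ℝ` for `1 ≤ j ≤ n`
(and `0` for `j = 0` or `j > n`). -/
noncomputable def orderStat {n : ℕ} (u : Fin n → ℝ) (j : ℕ) : ℝ :=
  if h : 1 ≤ j ∧ j ≤ n then u (Tuple.sort u ⟨j - 1, by omega⟩) else 0

lemma log_bound {x : ℝ} (hx : 0 < x) (hx2 : x ≤ 1/2) :
    1 + (1/x - 1) * Real.log (1 - x) ≤ x/2 + x^2/4 := by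
  have h := Real.hasSum_pow_div_log_of_abs_lt_one (x := x) (by rw [abs_lt]; constructor <;> linarith)
  have h2 := sum_le_hasSum (Finset.range 5) (fun i _ => by positivity) h
  simp only [Finset.sum_range_succ, Finset.sum_range_zero] at h2
  norm_num at h2
  have h3 : (1/x - 1) * Real.log (1 - x) ≤ (1/x - 1) * (-(x + x ^ 2 / 2 + x ^ 3 / 3 + x ^ 4 / 4 + x ^ 5 / 5)) := by
    apply mul_le_mul_of_nonneg_left (by linarith)
    rw [sub_nonneg, le_div_iff₀ hx]; linarith
  have h4 : (1/x - 1) * (-(x + x ^ 2 / 2 + x ^ 3 / 3 + x ^ 4 / 4 + x ^ 5 / 5))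
    = -1 + x/2 + x^2 * (1/6 + x/12 + x^2/20 + x^3/5) := by
    field_simp
    ring
  have h5 : 1/6 + x/12 + x^2/20 + x^3/5 ≤ 1/4 := by nlinarith [mul_pos hx hx, mul_nonneg hx.le (sub_nonneg.2 hx2), mul_nonneg (mul_pos hx hx).le (sub_nonneg.2 hx2)]
  have := mul_le_mul_of_nonneg_left h5 (sq_nonneg x)
  linarith

lemma sqrt_strict {x : ℝ} (h0 : 0 < x) (h1 : x < 1) : 1 - √(1 - x) < x / (2 - x) := by
  have hs : 0 < √(1-x) := Real.sqrt_pos.2 (by linarith)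
  have h2 := Real.sq_sqrt (show 0 ≤ 1 - x by linarith)
  rw [lt_div_iff₀ (by linarith)]
  generalize √(1-x) = s at *
  have hs1 : s < 1 := by nlinarith
  have hx : x = 1 - s^2 := by linarith
  subst hx
  nlinarith [mul_pos hs (pow_pos (sub_pos.2 hs1) 2)]

/-- the optimal constant -/
noncomputable def cst (n k : ℕ) : ℝ :=
  (n.descFactorial k : ℝ) / (n:ℝ)^k * ((1 - (k:ℝ)/n)^(n-k) * Real.exp k)

lemma cst_le (n k : ℕ) (hkn : k < n) : cst n k ≤ (1 - (k : ℝ) / n) ^ (-(1 / 2) : ℝ) := by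
  obtain ⟨m, rfl⟩ : ∃ m, n = m + 1 + k := ⟨n - k - 1, by omega⟩
  have h := Stirling.stirlingSeq'_antitone (show m ≤ m + k by omega)
  simp only [Function.comp, Stirling.stirlingSeq, Nat.succ_eq_add_one] at h
  have e1 : m + k + 1 = m + 1 + k := by ring
  rw [e1] at h
  have hf : ((m+1+k).factorial : ℝ) = (m+1).factorial * ((m+1+k).descFactorial k : ℝ) := by
    rw [← Nat.factorial_mul_descFactorial (show k ≤ m+1+k by omega)]; simp
  rw [hf] at h
  unfold cst
  have e2 : m + 1 + k - k = m + 1 := by omega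
  rw [e2]
  have hN : (0:ℝ) < ((m+1+k : ℕ):ℝ) := by positivity
  have hM : (0:ℝ) < ((m+1 : ℕ):ℝ) := by positivity
  have e3 : 1 - (k:ℝ)/((m+1+k : ℕ):ℝ) = ((m+1 : ℕ):ℝ)/((m+1+k : ℕ):ℝ) := by
    field_simp; push_cast; ring
  rw [e3, Real.rpow_neg (by positivity), ← Real.sqrt_eq_rpow, Real.sqrt_div hM.le, inv_div]
  generalize ((m+1+k).descFactorial k : ℝ) = d at *
  have hF : (0:ℝ) < (m+1).factorial := by positivity
  generalize ((m+1).factorial : ℝ) = F at *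
  generalize hNN : ((m+1+k : ℕ):ℝ) = N at *
  generalize ((m+1 : ℕ):ℝ) = M at *
  rw [Real.sqrt_mul (by norm_num), Real.sqrt_mul (by norm_num)] at h
  rw [div_pow, div_pow] at h
  have hE1 : Real.exp 1 ^ (m+1+k) = Real.exp 1 ^ (m+1) * Real.exp k := by
    rw [pow_add]; congr 1; rw [← Real.exp_nat_mul]; simp
  rw [hE1] at h
  have hs2 : 0 < √(2:ℝ) := by positivity
  have hsN : 0 < √N := by positivity
  have hsM : 0 < √M := by positivity
  have hE := Real.exp_pos 1
  have hk := Real.exp_pos (k:ℝ)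
  rw [div_pow, pow_add N (m+1) k] at *
  field_simp at h ⊢
  exact h

lemma cst_one_le (n : ℕ) (hn : 1 < n) : cst n 1 ≤ Real.exp (1 / (2 * n) + 1 / (4 * (n : ℝ) ^ 2)) := by
  have hn' : (2:ℝ) ≤ n := by exact_mod_cast hn
  have h := log_bound (x := 1/(n:ℝ)) (by positivity) (by rw [div_le_div_iff₀] <;> linarith)
  have hp : 0 < 1 - 1/(n:ℝ) := by
    rw [sub_pos, div_lt_one] <;> linarith
  have : cst n 1 = Real.exp (1 + (1/(1/(n:ℝ)) - 1) * Real.log (1 - 1/(n:ℝ))) := by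
    unfold cst
    rw [Real.exp_add, Nat.descFactorial_one, pow_one, div_self (by positivity), one_mul, mul_comm]
    congr 1
    · simp
    · rw [one_div_one_div, mul_comm, ← Real.rpow_def_of_pos hp, Nat.cast_one, ← Real.rpow_natCast]
      congr 1
      push_cast [hn.le]; ring
  rw [this]
  apply Real.exp_le_exp.2
  refine h.trans (le_of_eq ?_)
  field_simp

lemma dens_le (n k : ℕ) (hkn : k < n) (s : ℝ) :
    (n.descFactorial k : ℝ) * (((n:ℝ)^k)⁻¹ * (max (1 - s/n) 0)^(n-k)) ≤ cst n k * Real.exp (-s) := by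
  have hN : (0:ℝ) < n := by exact_mod_cast (by omega)
  have hm : (0:ℝ) < ((n-k:ℕ):ℝ) := by exact_mod_cast (by omega)
  have hmn : ((n-k:ℕ):ℝ) = n - k := by push_cast [hkn.le]; ring
  have h1 : max (1 - s/n) 0 ≤ (1 - (k:ℝ)/n) * Real.exp ((k-s)/((n-k:ℕ):ℝ)) := by
    have hp : 0 < 1 - (k:ℝ)/n := by
      rw [sub_pos, div_lt_one hN]; exact_mod_cast hkn
    apply max_le _ (by positivity)
    refine le_trans (le_of_eq ?_) (mul_le_mul_of_nonneg_left (Real.add_one_le_exp _) hp.le)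
    have hnk : (n:ℝ) - k ≠ 0 := by rw [← hmn]; exact hm.ne'
    rw [hmn]
    field_simp
    ring
  have h2 := pow_le_pow_left₀ (le_max_right _ _) h1 (n-k)
  rw [mul_pow, ← Real.exp_nat_mul, mul_div_cancel₀ _ hm.ne'] at h2
  calc _ ≤ (n.descFactorial k : ℝ) * (((n:ℝ)^k)⁻¹ * ((1 - (k:ℝ)/n)^(n-k) * Real.exp (k - s))) := by gcongr
    _ = _ := by
      unfold cst; rw [sub_eq_add_neg (k:ℝ) s, Real.exp_add]; ring

lemma tv_le {X : Type*} [MeasurableSpace X] (Q P : Measure X) [IsProbabilityMeasure Q]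
    [IsProbabilityMeasure P] (c : ℝ) (hc : 0 < c)
    (h : ∀ A, MeasurableSet A → Q A ≤ ENNReal.ofReal c * P A) : tvDist Q P ≤ 1 - c⁻¹ := by
  have h' : ∀ A, MeasurableSet A → Q.real A ≤ c * P.real A := by
    intro A hA
    have := ENNReal.toReal_mono (by finiteness) (h A hA)
    rwa [ENNReal.toReal_mul, ENNReal.toReal_ofReal hc.le] at this
  have h2 : ∀ A, MeasurableSet A → Q.real A - P.real A ≤ 1 - c⁻¹ := by
    intro A hA
    have a1 := h' A hA
    have a0 := h' Set.univ MeasurableSet.univ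
    simp at a0
    have a2 : Q.real A ≤ 1 := measureReal_le_one
    have a3 : c⁻¹ * Q.real A ≤ P.real A := by
      rw [inv_mul_le_iff₀ hc]; exact a1
    have a4 : c⁻¹ ≤ 1 := inv_le_one_of_one_le₀ a0
    nlinarith
  unfold tvDist
  have : Nonempty {A : Set X // MeasurableSet A} := ⟨⟨∅, MeasurableSet.empty⟩⟩
  apply ciSup_le
  rintro ⟨A, hA⟩
  have e1 := h2 A hA
  have e2 := h2 Aᶜ hA.compl
  rw [probReal_compl_eq_one_sub hA, probReal_compl_eq_one_sub hA] at e2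
  rw [abs_le]
  simp only [measureReal_def] at e1 e2
  constructor <;> linarith

lemma measurable_sort {n : ℕ} : @Measurable (Fin n → ℝ) (Equiv.Perm (Fin n)) _ ⊤ (fun u => Tuple.sort u) := by
  let : MeasurableSpace (Equiv.Perm (Fin n)) := ⊤
  apply measurable_to_countable'
  intro σ
  have : (fun u : Fin n → ℝ => Tuple.sort u) ⁻¹' {σ} =
    {u | (∀ i j, i ≤ j → u (σ i) ≤ u (σ j)) ∧ ∀ i j, i < j → u (σ i) = u (σ j) → σ i < σ j} := by
    ext u
    simp only [Set.mem_preimage, Set.mem_singleton_iff, Set.mem_ofPred_eq]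
    rw [eq_comm, Tuple.eq_sort_iff]
    rfl
  rw [this]
  measurability

lemma measurable_orderStat {n : ℕ} (j : ℕ) : Measurable (fun u : Fin n → ℝ => orderStat u j) := by
  unfold orderStat
  split_ifs with h
  · let : MeasurableSpace (Equiv.Perm (Fin n)) := ⊤
    have : MeasurableSingletonClass (Equiv.Perm (Fin n)) := ⟨fun _ => trivial⟩
    have h1 : Measurable (fun p : Equiv.Perm (Fin n) × (Fin n → ℝ) => p.2 (p.1 ⟨j - 1, by omega⟩)) :=
      measurable_from_prod_countable_right (fun σ => measurable_pi_apply (σ ⟨j - 1, by omega⟩))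
    exact h1.comp (measurable_sort.prodMk measurable_id)
  · exact measurable_const

lemma lintegral_fin_prod {k : ℕ} (f : Fin k → ℝ → ENNReal) (hf : ∀ i, Measurable (f i)) :
    ∫⁻ x : Fin k → ℝ, ∏ i, f i (x i) = ∏ i, ∫⁻ x, f i x := by
  induction k with
  | zero => simp [volume_pi]
  | succ n ih =>
    have h := (volume_preserving_piFinSuccAbove (fun _ : Fin (n+1) => ℝ) 0).symm
    rw [← h.lintegral_comp_emb (MeasurableEquiv.measurableEmbedding _), Fin.prod_univ_succ, ← ih _ (fun i => hf _)]
    rw [Measure.volume_eq_prod, ← lintegral_prod_mul (hf 0).aemeasurable]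
    · apply lintegral_congr
      intro p
      rw [Fin.prod_univ_succ]
      simp [MeasurableEquiv.piFinSuccAbove]
    · exact (Finset.measurable_prod _ (fun i _ => (hf _).comp (measurable_pi_apply i))).aemeasurable

lemma pi_exp (k : ℕ) : (Measure.pi fun _ : Fin k => expMeasure 1) =
    (volume : Measure (Fin k → ℝ)).withDensity (fun x => ∏ i, exponentialPDF 1 (x i)) := by
  have := isProbabilityMeasure_expMeasure (r := 1) one_pos
  have hm : Measurable (exponentialPDF 1) := (measurable_exponentialPDFReal 1).ennreal_ofReal
  apply Measure.pi_eq
  intro s hs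
  rw [withDensity_apply _ (MeasurableSet.univ_pi hs), ← lintegral_indicator (MeasurableSet.univ_pi hs)]
  have : ∀ i, expMeasure 1 (s i) = ∫⁻ x, (s i).indicator (exponentialPDF 1) x := by
    intro i
    rw [lintegral_indicator (hs i), expMeasure, gammaMeasure, withDensity_apply _ (hs i)]
    rfl
  simp_rw [this]
  rw [← lintegral_fin_prod _ (fun i => hm.indicator (hs i))]
  apply lintegral_congr
  intro x
  by_cases hx : x ∈ Set.univ.pi s
  · rw [Set.indicator_of_mem hx]
    apply Finset.prod_congr rfl
    intro i _
    rw [Set.indicator_of_mem (hx i trivial)]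
  · rw [Set.indicator_of_notMem hx]
    simp only [Set.mem_pi, Set.mem_univ, true_imp_iff, not_forall] at hx
    obtain ⟨i, hi⟩ := hx
    exact (Finset.prod_eq_zero (Finset.mem_univ i) (Set.indicator_of_notMem hi _)).symm


/-- `0`, followed by `v`. -/
noncomputable def extv {k : ℕ} (v : Fin k → ℝ) (j : ℕ) : ℝ :=
  if h : 1 ≤ j ∧ j ≤ k then v ⟨j - 1, by omega⟩ else 0

/-- scaled differences -/
noncomputable def diffs (n : ℕ) {k : ℕ} (v : Fin k → ℝ) : Fin k → ℝ :=
  fun j => (n : ℝ) * (extv v (j.1 + 1) - extv v j.1)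

lemma extv_succ {k : ℕ} (v : Fin k → ℝ) (j : Fin k) : extv v (j.1+1) = v j := by
  unfold extv
  rw [dif_pos ⟨by omega, by omega⟩]; rfl

lemma sum_diffs (n : ℕ) {k : ℕ} (v : Fin k → ℝ) : ∑ j, diffs n v j = n * extv v k := by
  unfold diffs
  rw [← Finset.mul_sum, Finset.sum_fin_eq_sum_range]
  congr 1
  rw [Finset.sum_congr rfl (g := fun i => extv v (i+1) - extv v i), Finset.sum_range_sub]
  · simp [extv]
  · intro i hi
    rw [dif_pos (Finset.mem_range.1 hi)]

/-- the difference matrix -/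
noncomputable def dmat (n k : ℕ) : Matrix (Fin k) (Fin k) ℝ :=
  fun i j => (if i = j then (n:ℝ) else 0) - (if j.1 + 1 = i.1 then (n:ℝ) else 0)

lemma dmat_mulVec (n k : ℕ) (v : Fin k → ℝ) : Matrix.toLin' (dmat n k) v = diffs n v := by
  ext i
  rw [Matrix.toLin'_apply]
  simp only [Matrix.mulVec, dotProduct, dmat, diffs, sub_mul, Finset.sum_sub_distrib, ite_mul, zero_mul,
    mul_sub, extv_succ]
  congr 1
  · simp
  · unfold extv
    split_ifs with h
    · rw [Finset.sum_eq_single ⟨i.1 - 1, by omega⟩]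
      · rw [if_pos (by simp; omega)]
      · intro b _ hb
        rw [if_neg]
        intro hh
        apply hb
        ext; simp; omega
      · simp
    · rw [mul_zero]
      apply Finset.sum_eq_zero
      intro j _
      rw [if_neg (by omega)]

lemma dmat_det (n k : ℕ) : (dmat n k).det = (n:ℝ)^k := by
  rw [Matrix.det_of_isLowerTriangular]
  · simp [dmat]
  · intro i j hij
    have : i < j := hij
    have h2 : i.1 < j.1 := this
    simp only [dmat]
    rw [if_neg this.ne, if_neg (by omega)]; simp

lemma measurable_diffs (n k : ℕ) : Measurable (diffs n : (Fin k → ℝ) → Fin k → ℝ) := by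
  have : (diffs n : (Fin k → ℝ) → Fin k → ℝ) = Matrix.toLin' (dmat n k) := by
    ext v; rw [dmat_mulVec]
  rw [this]
  exact (LinearMap.continuous_of_finiteDimensional _).measurable

lemma map_diffs (n k : ℕ) (hn : 0 < n) : Measure.map (diffs n) (volume : Measure (Fin k → ℝ)) =
    ENNReal.ofReal (((n:ℝ)^k)⁻¹) • volume := by
  have : (diffs n : (Fin k → ℝ) → Fin k → ℝ) = Matrix.toLin' (dmat n k) := by
    ext v; rw [dmat_mulVec]
  have hp : (0:ℝ) < (n:ℝ)^k := by positivity
  rw [this, Real.map_matrix_volume_pi_eq_smul_volume_pi (by rw [dmat_det]; exact hp.ne'), dmat_det, abs_of_pos (by positivity)]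

lemma measurable_extv {k : ℕ} (j : ℕ) : Measurable (fun v : Fin k → ℝ => extv v j) := by
  unfold extv
  split_ifs <;> fun_prop

lemma mp_split {n k : ℕ} (σ : Fin k ↪ Fin n) (μ : Measure ℝ) [SigmaFinite μ] :
    MeasurePreserving (fun u : Fin n → ℝ => (fun i => u (σ i), fun i : ↥(Set.range σ)ᶜ => u i))
      (Measure.pi fun _ => μ) ((Measure.pi fun _ => μ).prod (Measure.pi fun _ => μ)) := by
  classical
  let e : Fin k ⊕ ↥(Set.range σ)ᶜ ≃ Fin n :=
    (Equiv.sumCongr (Equiv.ofInjective σ σ.injective) (Equiv.refl _)).trans (Equiv.Set.sumCompl (Set.range σ))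
  have h1 := (measurePreserving_piCongrLeft (fun _ : Fin n => μ) e).symm
  have h2 := measurePreserving_sumPiEquivProdPi (fun _ : Fin k ⊕ ↥(Set.range σ)ᶜ => μ)
  exact h2.comp h1

lemma term_bound {n k : ℕ} (hn : 0 < n) (σ : Fin k ↪ Fin n) (B : Set (Fin k → ℝ))
    (hB : MeasurableSet B) (hB0 : ∀ x ∈ B, ∀ j, 0 ≤ x j) :
    (Measure.pi fun _ : Fin n => volume.restrict (Set.Icc (0 : ℝ) 1))
      {u | diffs n (fun i => u (σ i)) ∈ B ∧ ∀ i, i ∉ Set.range σ → extv (fun i => u (σ i)) k ≤ u i} ≤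
    ENNReal.ofReal (((n:ℝ)^k)⁻¹) * ∫⁻ x in B, ENNReal.ofReal (1 - (∑ j, x j)/n) ^ (n-k) := by
  classical
  set μ : Measure ℝ := volume.restrict (Set.Icc (0 : ℝ) 1) with hμ
  let S : Set ((Fin k → ℝ) × (↥(Set.range σ)ᶜ → ℝ)) := {p | diffs n p.1 ∈ B ∧ ∀ i, extv p.1 k ≤ p.2 i}
  have hS : MeasurableSet S := by
    refine MeasurableSet.inter (((measurable_diffs n k).comp measurable_fst) hB) ?_
    have : {p : (Fin k → ℝ) × (↥(Set.range σ)ᶜ → ℝ) | ∀ i, extv p.1 k ≤ p.2 i} = ⋂ i, {p | extv p.1 k ≤ p.2 i} := by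
      ext; simp
    change MeasurableSet {p : (Fin k → ℝ) × (↥(Set.range σ)ᶜ → ℝ) | ∀ i, extv p.1 k ≤ p.2 i}
    rw [this]
    refine MeasurableSet.iInter fun i => measurableSet_le ((measurable_extv k).comp measurable_fst) ?_
    fun_prop
  have hg : Measurable (fun x : Fin k → ℝ => ENNReal.ofReal (1 - (∑ j, x j)/n) ^ (n-k)) := by fun_prop
  have e1 : {u : Fin n → ℝ | diffs n (fun i => u (σ i)) ∈ B ∧ ∀ i, i ∉ Set.range σ → extv (fun i => u (σ i)) k ≤ u i} =
     (fun u : Fin n → ℝ => ((fun i => u (σ i) : Fin k → ℝ), fun i : ↥(Set.range σ)ᶜ => u i)) ⁻¹' S := by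
    ext u
    simp [S]
  rw [e1, (mp_split σ μ).measure_preimage hS.nullMeasurableSet, Measure.prod_apply hS]
  have hcard : Fintype.card ↥(Set.range σ)ᶜ = n - k := by
    rw [Fintype.card_compl_set, Set.card_range_of_injective σ.injective]; simp
  have key : ∀ v : Fin k → ℝ, (Measure.pi fun _ : ↥(Set.range σ)ᶜ => μ) (Prod.mk v ⁻¹' S) ≤
      B.indicator (fun x : Fin k → ℝ => ENNReal.ofReal (1 - (∑ j, x j)/n) ^ (n-k)) (diffs n v) := by
    intro v
    by_cases hv : diffs n v ∈ B
    · rw [Set.indicator_of_mem hv, sum_diffs]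
      have hn' : (0:ℝ) < n := by exact_mod_cast hn
      rw [mul_div_cancel_left₀ _ hn'.ne']
      have h0 : 0 ≤ extv v k := by
        have : 0 ≤ n * extv v k := by
          rw [← sum_diffs]; exact Finset.sum_nonneg (fun j _ => hB0 _ hv j)
        exact nonneg_of_mul_nonneg_right this hn'
      have : Prod.mk v ⁻¹' S = Set.univ.pi (fun _ => Set.Ici (extv v k)) := by
        ext w; simp only [S, Set.mem_preimage, Set.mem_ofPred_eq, Set.mem_univ_pi, Set.mem_Ici, hv, true_and]
      rw [this, Measure.pi_pi, Finset.prod_const, Finset.card_univ, hcard]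
      gcongr
      rw [hμ, Measure.restrict_apply measurableSet_Ici, ← Real.volume_Icc]
      exact measure_mono (fun x hx => ⟨hx.1, hx.2.2⟩)
    · have : Prod.mk v ⁻¹' S = ∅ := by
        ext w; simp [S, hv]
      rw [this]; simp
  calc _ ≤ ∫⁻ v, B.indicator (fun x : Fin k → ℝ => ENNReal.ofReal (1 - (∑ j, x j)/n) ^ (n-k)) (diffs n v) ∂(Measure.pi fun _ : Fin k => μ) := lintegral_mono key
    _ ≤ ∫⁻ v, B.indicator (fun x : Fin k → ℝ => ENNReal.ofReal (1 - (∑ j, x j)/n) ^ (n-k)) (diffs n v) := by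
      apply lintegral_mono' _ le_rfl
      rw [hμ, ← Measure.restrict_pi_pi]
      exact Measure.restrict_le_self
    _ = _ := by
      rw [← lintegral_map (hg.indicator hB) (measurable_diffs n k), map_diffs n k hn, lintegral_smul_measure,
        lintegral_indicator hB, smul_eq_mul]

lemma main_bound (n k : ℕ) (hkn : k < n) (A : Set (Fin k → ℝ)) (hA : MeasurableSet A) :
    (Measure.pi fun _ : Fin n => volume.restrict (Set.Icc (0 : ℝ) 1))
      {u : Fin n → ℝ | (fun j : Fin k => (n : ℝ) * (orderStat u (j.1 + 1) - orderStat u j.1)) ∈ A} ≤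
    ENNReal.ofReal (cst n k) * (Measure.pi fun _ : Fin k => expMeasure 1) A := by
  classical
  have hn : 0 < n := by omega
  set μ : Measure (Fin n → ℝ) := Measure.pi fun _ : Fin n => volume.restrict (Set.Icc (0 : ℝ) 1) with hμ
  let B : Set (Fin k → ℝ) := A ∩ {x | ∀ j, 0 ≤ x j}
  have hB : MeasurableSet B := hA.inter (by measurability)
  let T : (Fin k ↪ Fin n) → Set (Fin n → ℝ) := fun σ =>
    {u | diffs n (fun i => u (σ i)) ∈ B ∧ ∀ i, i ∉ Set.range σ → extv (fun i => u (σ i)) k ≤ u i}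
  have hsub : {u : Fin n → ℝ | (fun j : Fin k => (n : ℝ) * (orderStat u (j.1 + 1) - orderStat u j.1)) ∈ A}
      ≤ᵐ[μ] (⋃ σ, T σ : Set (Fin n → ℝ)) := by
    have hae : ∀ᵐ u ∂μ, ∀ i, 0 ≤ u i := by
      rw [ae_all_iff]
      intro i
      have h1 : ∀ᵐ x ∂((volume : Measure ℝ).restrict (Set.Icc (0 : ℝ) 1)), 0 ≤ x := by
        filter_upwards [ae_restrict_mem measurableSet_Icc] with x hx using hx.1
      exact (Measure.quasiMeasurePreserving_eval (fun _ : Fin n => volume.restrict (Set.Icc (0 : ℝ) 1)) i).ae h1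
    filter_upwards [hae] with u hu hmem
    let σ : Fin k ↪ Fin n := (Fin.castLEEmb hkn.le).trans (Tuple.sort u).toEmbedding
    have hmono := Tuple.monotone_sort u
    have hσ : ∀ j : ℕ, j ≤ k → extv (fun i => u (σ i)) j = orderStat u j := by
      intro j hj
      unfold extv orderStat
      by_cases h : 1 ≤ j
      · rw [dif_pos ⟨h, hj⟩, dif_pos ⟨h, by omega⟩]
        rfl
      · rw [dif_neg (by omega), dif_neg (by omega)]
    have hd : diffs n (fun i => u (σ i)) =
        (fun j : Fin k => (n : ℝ) * (orderStat u (j.1 + 1) - orderStat u j.1)) := by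
      ext j
      unfold diffs
      rw [hσ _ (by omega), hσ _ (by omega)]
    refine Set.mem_iUnion.2 ⟨σ, ⟨?_, ?_⟩, ?_⟩
    · rw [hd]; exact hmem
    · intro j
      apply mul_nonneg (by positivity)
      rw [sub_nonneg, extv_succ]
      unfold extv
      split_ifs with h
      · apply hmono
        rw [Fin.le_def]
        simp
      · exact hu _
    · intro i hi
      unfold extv
      split_ifs with h
      · obtain ⟨p, rfl⟩ := (Tuple.sort u).surjective i
        apply hmono
        rw [Fin.le_def]
        by_contra hlt
        apply hi
        simp at hlt
        refine ⟨⟨p.1, by omega⟩, ?_⟩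
        rfl
      · exact hu _
  have hm : Measurable (fun x : Fin k → ℝ => ENNReal.ofReal (1 - (∑ j, x j)/n) ^ (n-k)) := by fun_prop
  calc _ ≤ μ (⋃ σ, T σ) := measure_mono_ae hsub
    _ ≤ ∑ σ, μ (T σ) := measure_iUnion_fintype_le _ _
    _ ≤ ∑ σ : Fin k ↪ Fin n, ENNReal.ofReal (((n:ℝ)^k)⁻¹) * ∫⁻ x in B, ENNReal.ofReal (1 - (∑ j, x j)/n) ^ (n-k) :=
      Finset.sum_le_sum (fun σ _ => term_bound hn σ B hB (fun x hx => hx.2))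
    _ = ∫⁻ x in B, (n.descFactorial k : ENNReal) * (ENNReal.ofReal (((n:ℝ)^k)⁻¹) * ENNReal.ofReal (1 - (∑ j, x j)/n) ^ (n-k)) := by
      rw [Finset.sum_const, Finset.card_univ, Fintype.card_embedding_eq, nsmul_eq_mul,
        lintegral_const_mul _ (hm.const_mul _), lintegral_const_mul _ hm]
      simp
    _ ≤ ∫⁻ x in B, ENNReal.ofReal (cst n k) * ∏ i, exponentialPDF 1 (x i) := by
      apply setLIntegral_mono' hB
      intro x hx
      have hx0 := hx.2
      have hc : 0 ≤ cst n k := by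
        have : (0:ℝ) ≤ 1 - (k:ℝ)/n := by
          rw [sub_nonneg, div_le_one (by positivity)]; exact_mod_cast hkn.le
        unfold cst; positivity
      have e1 : ∏ i, exponentialPDF 1 (x i) = ENNReal.ofReal (Real.exp (-(∑ i, x i))) := by
        rw [← Finset.sum_neg_distrib, Real.exp_sum, ENNReal.ofReal_prod_of_nonneg (fun i _ => (Real.exp_pos _).le)]
        apply Finset.prod_congr rfl
        intro i _
        rw [exponentialPDF_of_nonneg (hx0 i)]; simp
      have e2 : ENNReal.ofReal (1 - (∑ j, x j)/n) = ENNReal.ofReal (max (1 - (∑ j, x j)/n) 0) := by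
        rw [ENNReal.ofReal_max]; simp
      rw [e1, e2, ← ENNReal.ofReal_pow (le_max_right _ _), ← ENNReal.ofReal_natCast,
        ← ENNReal.ofReal_mul (by positivity), ← ENNReal.ofReal_mul (by positivity), ← ENNReal.ofReal_mul hc]
      exact ENNReal.ofReal_le_ofReal (dens_le n k hkn _)
    _ ≤ ∫⁻ x in A, ENNReal.ofReal (cst n k) * ∏ i, exponentialPDF 1 (x i) :=
      lintegral_mono_set Set.inter_subset_left
    _ = _ := by
      have hp : Measurable (exponentialPDF 1) := (measurable_exponentialPDFReal 1).ennreal_ofReal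
      rw [lintegral_const_mul, pi_exp, withDensity_apply _ hA]
      fun_prop

/-- Corollary 3 (uniform spacings): let `Q_{n,k}` be the law of the first `k`
rescaled uniform spacings `n(U_{n:j} - U_{n:j-1})`, `j = 1,…,k`, and `P_k` the
`k`-fold product of the standard exponential distribution. Then
`Q_{n,k}(A) ≤ (1 - k/n)^{-1/2} P_k(A)` for all Borel `A`, with the improved factor
`exp(1/(2n) + 1/(4n²))` when `k = 1`; consequently
`d_TV(Q_{n,k},P_k) ≤ 1 - √(1-k/n) < k/(2n-k)` and
`d_TV(Q_{n,1},P_1) ≤ 1/(2n) + 1/(4n²)`. -/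
theorem uniform_spacings_exponential (n k : ℕ) (hk : 1 ≤ k) (hkn : k < n)
    (Q : Measure (Fin k → ℝ)) (P : Measure (Fin k → ℝ))
    (hQ : Q = Measure.map
      (fun u : Fin n → ℝ => fun j : Fin k =>
        (n : ℝ) * (orderStat u (j.1 + 1) - orderStat u j.1))
      (Measure.pi fun _ : Fin n => volume.restrict (Set.Icc (0 : ℝ) 1)))
    (hP : P = Measure.pi fun _ : Fin k => expMeasure 1) :
    (∀ A : Set (Fin k → ℝ), MeasurableSet A →
      Q A ≤ ENNReal.ofReal ((1 - (k : ℝ) / n) ^ (-(1 / 2) : ℝ)) * P A) ∧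
    (k = 1 → ∀ A : Set (Fin k → ℝ), MeasurableSet A →
      Q A ≤ ENNReal.ofReal (Real.exp (1 / (2 * n) + 1 / (4 * (n : ℝ) ^ 2))) * P A) ∧
    tvDist Q P ≤ 1 - Real.sqrt (1 - (k : ℝ) / n) ∧
    1 - Real.sqrt (1 - (k : ℝ) / n) < (k : ℝ) / (2 * n - k) ∧
    (k = 1 → tvDist Q P ≤ 1 / (2 * n) + 1 / (4 * (n : ℝ) ^ 2)) := by
  have hk0 : (0:ℝ) < k := by exact_mod_cast hk
  have hkn' : (k:ℝ) < n := by exact_mod_cast hkn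
  have hn0 : (0:ℝ) < n := hk0.trans hkn'
  have hx0 : 0 < (k:ℝ)/n := by positivity
  have hx1 : (k:ℝ)/n < 1 := by rwa [div_lt_one hn0]
  have hmeas : Measurable (fun u : Fin n → ℝ => fun j : Fin k =>
        (n : ℝ) * (orderStat u (j.1 + 1) - orderStat u j.1)) := by
    apply measurable_pi_lambda
    intro j
    exact ((measurable_orderStat _).sub (measurable_orderStat _)).const_mul _
  have hmain : ∀ A : Set (Fin k → ℝ), MeasurableSet A → Q A ≤ ENNReal.ofReal (cst n k) * P A := by
    intro A hA
    rw [hQ, hP, Measure.map_apply hmeas hA]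
    exact main_bound n k hkn A hA
  have hI : IsProbabilityMeasure ((volume : Measure ℝ).restrict (Set.Icc (0:ℝ) 1)) := ⟨by simp⟩
  have hE := isProbabilityMeasure_expMeasure (r := 1) one_pos
  have hQp : IsProbabilityMeasure Q := by
    rw [hQ]; exact Measure.isProbabilityMeasure_map hmeas.aemeasurable
  have hPp : IsProbabilityMeasure P := by
    rw [hP]; infer_instance
  have h1 : ∀ A : Set (Fin k → ℝ), MeasurableSet A →
      Q A ≤ ENNReal.ofReal ((1 - (k : ℝ) / n) ^ (-(1 / 2) : ℝ)) * P A := fun A hA =>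
    (hmain A hA).trans (by gcongr; exact cst_le n k hkn)
  have h2 : k = 1 → ∀ A : Set (Fin k → ℝ), MeasurableSet A →
      Q A ≤ ENNReal.ofReal (Real.exp (1 / (2 * n) + 1 / (4 * (n : ℝ) ^ 2))) * P A := by
    intro hk1 A hA
    refine (hmain A hA).trans ?_
    have h3 : cst n k ≤ Real.exp (1 / (2 * n) + 1 / (4 * (n : ℝ) ^ 2)) := by
      rw [hk1]; exact cst_one_le n (by omega)
    gcongr
  refine ⟨h1, h2, ?_, ?_, ?_⟩
  · have h := tv_le Q P _ (Real.rpow_pos_of_pos (sub_pos.2 hx1) _) h1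
    rwa [Real.rpow_neg (sub_pos.2 hx1).le, inv_inv, ← Real.sqrt_eq_rpow] at h
  · refine (sqrt_strict hx0 hx1).trans_le (le_of_eq ?_)
    have : (2 * n - k : ℝ) ≠ 0 := by linarith
    have : (2 - k/n : ℝ) ≠ 0 := by linarith
    field_simp
  · intro hk1
    have h := tv_le Q P _ (Real.exp_pos _) (h2 hk1)
    rw [← Real.exp_neg] at h
    have := Real.add_one_le_exp (-(1 / (2 * (n:ℝ)) + 1 / (4 * (n : ℝ) ^ 2)))
    linarith
end
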